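/- There is a constant c > 0 and an integer N such that for all n ≥ N and every real ℓ > 0, the probability under the uniform distribution P_n on Ω_n of the event { f : log B(f) − log T(f) ≥ ℓ } is at most c · log n · (log log n)² / ℓ. -/

import Mathlib

open scoped Classical
open Function

namespace IterMap

noncomputable section

/-- A vertex `v` is cyclic for `f` if some positive iterate of `f` fixes `v`. -/
def IsCyclic {n : ℕ} (f : Fin n → Fin n) (v : Fin n) : Prop :=
  ∃ t, 0 < t ∧ f^[t] v = v

theorem isCyclic_apply {n : ℕ} {f : Fin n → Fin n} {v : Fin n} (h : IsCyclic f v) :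
    IsCyclic f (f v) := by
  obtain ⟨t, ht, hv⟩ := h
  refine ⟨t, ht, ?_⟩
  calc f^[t] (f v) = f^[t + 1] v := (Function.iterate_succ_apply f t v).symm
    _ = f (f^[t] v) := Function.iterate_succ_apply' f t v
    _ = f v := by rw [hv]

/-- The permutation induced by `f` on its cyclic vertices. -/
def cyclicPerm {n : ℕ} (f : Fin n → Fin n) :
    Equiv.Perm {v : Fin n // IsCyclic f v} :=
  Equiv.ofBijective (fun v => ⟨f v.1, isCyclic_apply v.2⟩) (by
    rw [← Finite.injective_iff_bijective]
    intro u v huv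
    have h1 : f u.1 = f v.1 := congrArg Subtype.val huv
    obtain ⟨s, hs, hsu⟩ := u.2
    obtain ⟨t, ht, htv⟩ := v.2
    have hu : f^[s * t] u.1 = u.1 := by
      rw [Function.iterate_mul]
      exact Function.iterate_fixed hsu t
    have hv : f^[s * t] v.1 = v.1 := by
      rw [mul_comm, Function.iterate_mul]
      exact Function.iterate_fixed htv s
    have hst : 0 < s * t := Nat.mul_pos hs ht
    obtain ⟨k, hk⟩ : ∃ k, s * t = k + 1 := ⟨s * t - 1, by omega⟩
    apply Subtype.ext
    calc u.1 = f^[s * t] u.1 := hu.symm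
      _ = f^[k] (f u.1) := by rw [hk, Function.iterate_succ_apply]
      _ = f^[k] (f v.1) := by rw [h1]
      _ = f^[s * t] v.1 := by rw [hk, Function.iterate_succ_apply]
      _ = v.1 := hv)

/-- `T f`: the (eventual) period of the sequence of iterates of `f`. -/
def T {n : ℕ} (f : Fin n → Fin n) : ℕ :=
  sInf {T : ℕ | 0 < T ∧ ∀ m, n ≤ m → f^[m + T] = f^[m]}

/-- `B f`: the product of the lengths of the cycles of `f`. -/
def B {n : ℕ} (f : Fin n → Fin n) : ℕ :=
  (cyclicPerm f).cycleType.prod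

/-- `Z f`: the number of cyclic vertices of `f`. -/
def Z {n : ℕ} (f : Fin n → Fin n) : ℕ :=
  Nat.card {v : Fin n // IsCyclic f v}

/-- `O f`: the number of distinct positive iterates of `f`. -/
def O {n : ℕ} (f : Fin n → Fin n) : ℕ :=
  Nat.card {g : Fin n → Fin n // ∃ t, 0 < t ∧ g = f^[t]}

/-- `f` is connected if its functional graph has one weak component. -/
def Connected {n : ℕ} (f : Fin n → Fin n) : Prop :=
  ∀ u v : Fin n, ∃ s t : ℕ, f^[s] u = f^[t] v

/-- The set of connected mappings on `[n]`. -/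
def Un (n : ℕ) : Finset (Fin n → Fin n) :=
  Finset.univ.filter fun f => Connected f

/-- `kappa n`: the average cycle length of a uniform random connected mapping. -/
def kappa (n : ℕ) : ℝ :=
  (∑ f ∈ Un n, (Z f : ℝ)) / (Un n).card

def c (d : ℕ) : ℝ :=
  ((kappa d - 1) / d) * Real.exp (-(d : ℝ)) *
    ∑ k ∈ Finset.range d, (d : ℝ) ^ k / (k.factorial : ℝ)

def F (z : ℝ) : ℝ := (1 / (1 - z)) * Real.exp (∑' d : ℕ, c d * z ^ d)

def mu (m : ℕ) : ℝ := iteratedDeriv m F 0 / (m.factorial : ℝ)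

def g (s : ℝ) : ℝ := ∑' d : ℕ, c d * Real.exp (-(d : ℝ) * s)

/-- `M m`: the average order of a uniform random permutation of `[m]`. -/
def M (m : ℕ) : ℝ :=
  (∑ σ : Equiv.Perm (Fin m), (orderOf σ : ℝ)) / (m.factorial : ℝ)

def I : ℝ :=
  ∫ t in Set.Ioi (0 : ℝ), Real.log (Real.log (Real.exp 1 / (1 - Real.exp (-t))))

def beta0 : ℝ := Real.sqrt (8 * I)

def k0 : ℝ := (3 / 2) * (3 * I) ^ ((2 : ℝ) / 3)

end

theorem iter_agree {α : Type*} (f g : α → α) (u : α) (i : ℕ)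
    (h : ∀ j < i, g (f^[j] u) = f (f^[j] u)) : g^[i] u = f^[i] u := by
  induction i with
  | zero => rfl
  | succ i ih =>
    rw [Function.iterate_succ_apply', Function.iterate_succ_apply', ih (fun j hj => h j (by omega)),
      h i (by omega)]

theorem iter_ne {α : Type*} (f : α → α) (u : α) (d : ℕ)
    (hu : Function.minimalPeriod f u = d) (j : ℕ) (hj : j < d - 1) :
    f^[j] u ≠ f^[d-1] u := by
  intro h
  have := (Function.iterate_injOn_Iio_minimalPeriod (f := f) (x := u))
    (by simp; omega) (by simp; omega) h
  omega

theorem iter_last {α : Type*} (f : α → α) (u : α) (d : ℕ) (hd : 0 < d)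
    (hu : Function.minimalPeriod f u = d) : f (f^[d-1] u) = u := by
  rw [← Function.iterate_succ_apply' f, Nat.succ_eq_add_one, Nat.sub_add_cancel hd, ← hu]
  exact Function.iterate_minimalPeriod

theorem count1 {n : ℕ} (v : Fin n) (d : ℕ) (hd : 0 < d) :
    n * (Finset.univ.filter fun f : Fin n → Fin n => Function.minimalPeriod f v = d).card
      ≤ n ^ n := by
  have key : ((Finset.univ.filter fun f : Fin n → Fin n => Function.minimalPeriod f v = d) ×ˢ
      (Finset.univ : Finset (Fin n))).card ≤ (Finset.univ : Finset (Fin n → Fin n)).card := by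
    apply Finset.card_le_card_of_injOn
      (fun p => Function.update p.1 (p.1^[d-1] v) p.2)
    · intro x _; simp
    · have rec0 : ∀ (f : Fin n → Fin n) (a : Fin n), Function.minimalPeriod f v = d →
          (Function.update f (f^[d-1] v) a)^[d-1] v = f^[d-1] v := by
        intro f a hf
        apply iter_agree
        intro j hj
        exact Function.update_of_ne (iter_ne f v d hf j hj) _ _
      rintro ⟨f, a⟩ hf ⟨f', a'⟩ hf' h
      simp only [Finset.coe_product, Finset.coe_filter, Finset.mem_univ, true_and,
        Finset.coe_univ, Set.mem_prod, Set.mem_ofPred_eq, Set.mem_univ, and_true] at hf hf'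
      dsimp only at h
      have h1 := rec0 f a hf
      have h2 := rec0 f' a' hf'
      rw [h, h2] at h1
      rw [h1] at h h2
      have ha : a = a' := by
        have := congrFun h (f^[d-1] v); simpa using this
      have hff : f = f' := by
        funext x
        by_cases hx : x = f^[d-1] v
        · have e1 := iter_last f v d hd hf
          have e2 := iter_last f' v d hd hf'
          rw [h1] at e2
          rw [hx, e1, e2]
        · have := congrFun h x
          simpa [Function.update_of_ne hx] using this
      rw [ha, hff]
  simpa [Finset.card_product, mul_comm] using key

theorem orbit_ne {α : Type*} (f : α → α) (u v : α) (e : ℕ) (he : 0 < e)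
    (hv : Function.minimalPeriod f v = e) (h : ∀ k, f^[k] u ≠ v) (i j : ℕ) :
    f^[i] u ≠ f^[j] v := by
  intro hij
  have hp : Function.IsPeriodicPt f (e * j) v := by
    have := Function.isPeriodicPt_minimalPeriod f v
    rw [hv] at this
    exact this.mul_const j
  have hle : j ≤ e * j := Nat.le_mul_of_pos_left j he
  apply h ((e * j - j) + i)
  rw [Function.iterate_add_apply, hij, ← Function.iterate_add_apply, Nat.sub_add_cancel hle]
  exact hp

theorem count2 {n : ℕ} (u v : Fin n) (d e : ℕ) (hd : 0 < d) (he : 0 < e) :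
    n ^ 2 * (Finset.univ.filter fun f : Fin n → Fin n => Function.minimalPeriod f u = d ∧
      Function.minimalPeriod f v = e ∧ ∀ k, f^[k] u ≠ v).card ≤ n ^ n := by
  have key : ((Finset.univ.filter fun f : Fin n → Fin n => Function.minimalPeriod f u = d ∧
      Function.minimalPeriod f v = e ∧ ∀ k, f^[k] u ≠ v) ×ˢ
      (Finset.univ : Finset (Fin n × Fin n))).card ≤
      (Finset.univ : Finset (Fin n → Fin n)).card := by
    apply Finset.card_le_card_of_injOn
      (fun p => Function.update (Function.update p.1 (p.1^[d-1] u) p.2.1) (p.1^[e-1] v) p.2.2)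
    · intro x _; simp
    · have rec1 : ∀ (f : Fin n → Fin n) (a b : Fin n), (Function.minimalPeriod f u = d ∧
          Function.minimalPeriod f v = e ∧ ∀ k, f^[k] u ≠ v) →
          (Function.update (Function.update f (f^[d-1] u) a) (f^[e-1] v) b)^[d-1] u
            = f^[d-1] u := by
        intro f a b hf
        apply iter_agree
        intro j hj
        rw [Function.update_of_ne (orbit_ne f u v e he hf.2.1 hf.2.2 j _)]
        exact Function.update_of_ne (iter_ne f u d hf.1 j hj) _ _
      have rec2 : ∀ (f : Fin n → Fin n) (a b : Fin n), (Function.minimalPeriod f u = d ∧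
          Function.minimalPeriod f v = e ∧ ∀ k, f^[k] u ≠ v) →
          (Function.update (Function.update f (f^[d-1] u) a) (f^[e-1] v) b)^[e-1] v
            = f^[e-1] v := by
        intro f a b hf
        apply iter_agree
        intro j hj
        rw [Function.update_of_ne (iter_ne f v e hf.2.1 j hj)]
        exact Function.update_of_ne (orbit_ne f u v e he hf.2.1 hf.2.2 _ _).symm _ _
      rintro ⟨f, a, b⟩ hf ⟨f', a', b'⟩ hf' h
      simp only [Finset.coe_product, Finset.coe_filter, Finset.mem_univ, true_and,
        Finset.coe_univ, Set.mem_prod, Set.mem_ofPred_eq, Set.mem_univ, and_true] at hf hf'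
      dsimp only at h
      have h1 := rec1 f a b hf
      have h2 := rec1 f' a' b' hf'
      have h3 := rec2 f a b hf
      have h4 := rec2 f' a' b' hf'
      rw [h, h2] at h1
      rw [h, h4] at h3
      rw [h1, h3] at h
      have hne := orbit_ne f u v e he hf.2.1 hf.2.2 (d-1) (e-1)
      have hb : b = b' := by
        have := congrFun h (f^[e-1] v); simpa using this
      have ha : a = a' := by
        have := congrFun h (f^[d-1] u)
        simpa [Function.update_of_ne hne] using this
      have hff : f = f' := by
        funext x
        by_cases hx : x = f^[d-1] u
        · have e1 := iter_last f u d hd hf.1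
          have e2 := iter_last f' u d hd hf'.1
          rw [h1] at e2
          rw [hx, e1, e2]
        · by_cases hy : x = f^[e-1] v
          · have e1 := iter_last f v e he hf.2.1
            have e2 := iter_last f' v e he hf'.2.1
            rw [h3] at e2
            rw [hy, e1, e2]
          · have := congrFun h x
            simpa [Function.update_of_ne hx, Function.update_of_ne hy] using this
      rw [ha, hb, hff]
  simpa [Finset.card_product, mul_comm, sq] using key

theorem T_spec {n : ℕ} (f : Fin n → Fin n) :
    0 < T f ∧ ∀ m, n ≤ m → f^[m + T f] = f^[m] := by
  have hne : {T : ℕ | 0 < T ∧ ∀ m, n ≤ m → f^[m + T] = f^[m]}.Nonempty := by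
    refine ⟨n.factorial, Nat.factorial_pos n, ?_⟩
    intro m hm
    funext v
    have hni : ¬ Function.Injective (fun i : Fin (n+1) => f^[(i:ℕ)] v) := by
      intro hi
      have := Fintype.card_le_of_injective _ hi
      simp at this
    rw [Function.Injective] at hni
    push Not at hni
    obtain ⟨i, j, hij, hne⟩ := hni
    have main : ∀ i j : ℕ, i < j → j ≤ n → f^[i] v = f^[j] v →
        f^[m + n.factorial] v = f^[m] v := by
      intro i j hlt hj hij
      have hper : Function.IsPeriodicPt f (j - i) (f^[m] v) := by
        have h1 : Function.IsPeriodicPt f (j - i) (f^[i] v) := by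
          rw [Function.IsPeriodicPt, Function.IsFixedPt, ← Function.iterate_add_apply,
            Nat.sub_add_cancel hlt.le, hij]
        have h2 := h1.apply_iterate (m - i)
        rwa [← Function.iterate_add_apply, Nat.sub_add_cancel (by omega)] at h2
      have hd : (j - i) ∣ n.factorial := Nat.dvd_factorial (by omega) (by omega)
      rw [add_comm, Function.iterate_add_apply]
      exact hper.trans_dvd hd
    rcases lt_or_gt_of_ne (fun h => hne (Fin.ext h) : (i:ℕ) ≠ j) with h | h
    · exact main i j h (by omega) hij
    · exact main j i h (by omega) hij.symm
  exact Nat.sInf_mem hne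

theorem per_dvd_T {n : ℕ} (f : Fin n → Fin n) (v : Fin n) (hv : IsCyclic f v) :
    Function.minimalPeriod f v ∣ T f := by
  obtain ⟨t, ht, hv⟩ := hv
  have hp : Function.IsPeriodicPt f (t * n) v := Function.IsPeriodicPt.mul_const hv n
  have := congrFun ((T_spec f).2 (t * n) (Nat.le_mul_of_pos_left n ht)) v
  rw [add_comm, Function.iterate_add_apply, hp] at this
  exact Function.IsPeriodicPt.minimalPeriod_dvd this

theorem cyclicPerm_pow {n : ℕ} (f : Fin n → Fin n) (x : {v : Fin n // IsCyclic f v}) (k : ℕ) :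
    ((cyclicPerm f ^ k) x).1 = f^[k] x.1 := by
  induction k with
  | zero => rfl
  | succ k ih =>
    rw [pow_succ', Function.iterate_succ_apply', ← ih]
    rfl

theorem card_support_eq {n : ℕ} (f : Fin n → Fin n) (c : Equiv.Perm {v : Fin n // IsCyclic f v})
    (hc : c ∈ (cyclicPerm f).cycleFactorsFinset) (x : {v : Fin n // IsCyclic f v})
    (hx : x ∈ c.support) : c.support.card = Function.minimalPeriod f x.1 := by
  have h1 := Equiv.Perm.isCycleOn_support_of_mem_cycleFactorsFinset hc
  have h2 : ∀ k, f^[k] x.1 = x.1 ↔ c.support.card ∣ k := by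
    intro k
    rw [← h1.pow_apply_eq hx, Subtype.ext_iff, cyclicPerm_pow]
  apply Nat.dvd_antisymm
  · exact (h2 _).1 Function.iterate_minimalPeriod
  · exact Function.IsPeriodicPt.minimalPeriod_dvd ((h2 _).2 dvd_rfl)

theorem diff_cycle {n : ℕ} (f : Fin n → Fin n) (c c' : Equiv.Perm {v : Fin n // IsCyclic f v})
    (hc : c ∈ (cyclicPerm f).cycleFactorsFinset) (hc' : c' ∈ (cyclicPerm f).cycleFactorsFinset)
    (hne : c ≠ c') (x y : {v : Fin n // IsCyclic f v})
    (hx : x ∈ c.support) (hy : y ∈ c'.support) (k : ℕ) : f^[k] x.1 ≠ y.1 := by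
  intro h
  rw [← cyclicPerm_pow, ← Subtype.ext_iff] at h
  have h1 : y ∈ c.support := by
    rw [← h]
    have := (Equiv.Perm.zpow_apply_mem_support_of_mem_cycleFactorsFinset_iff
      (c := ⟨c, hc⟩) (x := x) (m := (k:ℤ))).2 hx
    simpa using this
  have hd := Equiv.Perm.cycleFactorsFinset_pairwise_disjoint (cyclicPerm f) hc hc' hne
  exact Finset.disjoint_left.1 (Equiv.Perm.disjoint_iff_disjoint_support.1 hd) h1 hy

/-- the cycles of length divisible by `q` -/
noncomputable def Dset {n : ℕ} (f : Fin n → Fin n) (q : ℕ) :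
    Finset (Equiv.Perm {v : Fin n // IsCyclic f v}) :=
  (cyclicPerm f).cycleFactorsFinset.filter fun c => q ∣ c.support.card

noncomputable def wt {n : ℕ} (f : Fin n → Fin n) (q : ℕ) (v : Fin n) : ℝ :=
  if 0 < Function.minimalPeriod f v ∧ q ∣ Function.minimalPeriod f v then
    (1 : ℝ) / (Function.minimalPeriod f v : ℝ) else 0

theorem wt_nonneg {n : ℕ} (f : Fin n → Fin n) (q : ℕ) (v : Fin n) : 0 ≤ wt f q v := by
  unfold wt; split_ifs <;> positivity

theorem sum_wt {n : ℕ} (f : Fin n → Fin n) (q : ℕ)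
    (c : Equiv.Perm {v : Fin n // IsCyclic f v}) (hc : c ∈ Dset f q) :
    ∑ x ∈ c.support, wt f q x.1 = 1 := by
  rw [Dset, Finset.mem_filter] at hc
  have hcy := (Equiv.Perm.mem_cycleFactorsFinset_iff.1 hc.1).1
  have hpos : 0 < c.support.card := by have := hcy.two_le_card_support; omega
  rw [Finset.sum_congr rfl (g := fun _ => (1:ℝ) / c.support.card)]
  · rw [Finset.sum_const, nsmul_eq_mul]
    field_simp
  · intro x hx
    have := card_support_eq f c hc.1 x hx
    rw [wt, ← this, if_pos ⟨hpos, hc.2⟩]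

theorem sum_subtype_le {n : ℕ} (f : Fin n → Fin n) (g : Fin n → ℝ) (hg : ∀ v, 0 ≤ g v) :
    ∑ x : {v : Fin n // IsCyclic f v}, g x.1 ≤ ∑ v, g v := by
  rw [← Finset.sum_subtype (Finset.univ.filter (IsCyclic f)) (by simp) g]
  exact Finset.sum_le_sum_of_subset_of_nonneg
      (Finset.filter_subset (IsCyclic f) Finset.univ) (fun v _ _ => hg v)

theorem D1 {n : ℕ} (f : Fin n → Fin n) (q : ℕ) :
    ((Dset f q).card : ℝ) ≤ ∑ v, wt f q v := by
  have h1 : ((Dset f q).card : ℝ) = ∑ c ∈ Dset f q, ∑ x ∈ c.support, wt f q x.1 := by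
    rw [Finset.sum_congr rfl (fun c hc => sum_wt f q c hc)]; simp
  rw [h1, ← Finset.sum_biUnion]
  · exact (Finset.sum_le_sum_of_subset_of_nonneg (Finset.subset_univ _)
      (fun v _ _ => wt_nonneg f q _)).trans (sum_subtype_le f (wt f q) (wt_nonneg f q))
  · intro c hc c' hc' hne
    have hd := Equiv.Perm.cycleFactorsFinset_pairwise_disjoint (cyclicPerm f)
      (Finset.mem_filter.1 hc).1 (Finset.mem_filter.1 hc').1 hne
    exact Equiv.Perm.disjoint_iff_disjoint_support.1 hd

theorem D2 {n : ℕ} (f : Fin n → Fin n) (q : ℕ) :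
    ((Dset f q).card : ℝ) * ((Dset f q).card - 1) ≤
      ∑ u, ∑ v, if (∀ k, f^[k] u ≠ v) then wt f q u * wt f q v else 0 := by
  set G : Fin n → Fin n → ℝ := fun u v =>
    if (∀ k, f^[k] u ≠ v) then wt f q u * wt f q v else 0 with hG
  have hG0 : ∀ u v, 0 ≤ G u v := by
    intro u v
    simp only [hG]
    split_ifs
    · exact mul_nonneg (wt_nonneg _ _ _) (wt_nonneg _ _ _)
    · exact le_rfl
  have h1 : ((Dset f q).card : ℝ) * ((Dset f q).card - 1) =
      ∑ p ∈ (Dset f q).offDiag, ∑ x ∈ p.1.support ×ˢ p.2.support, G x.1.1 x.2.1 := by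
    have h2 : ∀ p ∈ (Dset f q).offDiag,
        ∑ x ∈ p.1.support ×ˢ p.2.support, G x.1.1 x.2.1 = 1 := by
      rintro ⟨c, c'⟩ hp
      rw [Finset.mem_offDiag] at hp
      obtain ⟨hc, hc', hne⟩ := hp
      dsimp only at hc hc' hne ⊢
      have h3 : ∀ x ∈ c.support ×ˢ c'.support, G x.1.1 x.2.1 = wt f q x.1.1 * wt f q x.2.1 := by
        intro x hx
        rw [Finset.mem_product] at hx
        simp only [hG]
        rw [if_pos]
        exact diff_cycle f c c' (Finset.mem_filter.1 hc).1 (Finset.mem_filter.1 hc').1 hne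
          x.1 x.2 hx.1 hx.2
      rw [Finset.sum_congr rfl h3, Finset.sum_product]
      simp only []
      rw [← Finset.sum_mul_sum, sum_wt f q c hc, sum_wt f q c' hc', one_mul]
    rw [Finset.sum_congr rfl h2, Finset.sum_const, Finset.offDiag_card, nsmul_eq_mul,
      Nat.cast_sub (Nat.le_mul_self _)]
    push_cast; ring
  rw [h1, ← Finset.sum_biUnion]
  · refine (Finset.sum_le_sum_of_subset_of_nonneg (Finset.subset_univ _)
      (fun v _ _ => hG0 _ _)).trans ?_
    rw [← Finset.univ_product_univ, Finset.sum_product]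
    refine le_trans ?_ (sum_subtype_le f (fun u => ∑ v, G u v)
      (fun u => Finset.sum_nonneg (fun v _ => hG0 u v)))
    apply Finset.sum_le_sum
    intro u _
    exact sum_subtype_le f (G u.1) (hG0 u.1)
  · rintro ⟨c, c'⟩ hc ⟨e, e'⟩ he hne
    simp only [Finset.coe_offDiag, Set.mem_offDiag, Finset.mem_coe] at hc he
    have hdis : ∀ a ∈ Dset f q, ∀ b ∈ Dset f q, a ≠ b → Disjoint a.support b.support := by
      intro a ha b hb hab
      have hd := Equiv.Perm.cycleFactorsFinset_pairwise_disjoint (cyclicPerm f)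
        (Finset.mem_filter.1 ha).1 (Finset.mem_filter.1 hb).1 hab
      exact Equiv.Perm.disjoint_iff_disjoint_support.1 hd
    show Disjoint (c.support ×ˢ c'.support) (e.support ×ˢ e'.support)
    rw [Finset.disjoint_product]
    by_cases h : c = e
    · right
      exact hdis _ hc.2.1 _ he.2.1 (fun h' => hne (by rw [h, h']))
    · left
      exact hdis _ hc.1 _ he.1 h

open ArithmeticFunction in
theorem log_B {n : ℕ} (f : Fin n → Fin n) :
    Real.log (B f) = ∑ q ∈ Finset.Icc 2 n, vonMangoldt q * (Dset f q).card := by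
  have hB : (B f : ℝ) = ∏ c ∈ (cyclicPerm f).cycleFactorsFinset, (c.support.card : ℝ) := by
    rw [B, Equiv.Perm.cycleType_def]
    push_cast
    rw [Multiset.map_map]
    rfl
  have h0 : ∀ c ∈ (cyclicPerm f).cycleFactorsFinset, 2 ≤ c.support.card ∧ c.support.card ≤ n := by
    intro c hc
    refine ⟨(Equiv.Perm.mem_cycleFactorsFinset_iff.1 hc).1.two_le_card_support, ?_⟩
    refine (Finset.card_le_univ _).trans ?_
    have := Fintype.card_subtype_le (IsCyclic f)
    simpa using this
  rw [hB, Real.log_prod (fun c hc => by have := (h0 c hc).1; positivity)]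
  have h1 : ∀ c ∈ (cyclicPerm f).cycleFactorsFinset, Real.log (c.support.card : ℝ) =
      ∑ q ∈ Finset.Icc 2 n, if q ∣ c.support.card then vonMangoldt q else 0 := by
    intro c hc
    have := h0 c hc
    rw [← vonMangoldt_sum, ← Finset.sum_filter]
    symm
    apply Finset.sum_subset
    · intro q hq
      simp only [Finset.mem_filter] at hq
      exact Nat.mem_divisors.2 ⟨hq.2, by omega⟩
    · intro q hq hq'
      rw [Nat.mem_divisors] at hq
      have hle := Nat.le_of_dvd (by omega) hq.1
      have : q = 1 := by
        by_contra h
        apply hq'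
        have : q ≠ 0 := by rintro rfl; simp at hq
        simp only [Finset.mem_filter, Finset.mem_Icc]
        exact ⟨by omega, hq.1⟩
      rw [this, vonMangoldt_apply_one]
  rw [Finset.sum_congr rfl h1, Finset.sum_comm]
  apply Finset.sum_congr rfl
  intro q _
  rw [Dset, ← Finset.sum_filter, Finset.sum_const, nsmul_eq_mul, mul_comm]

open ArithmeticFunction in
theorem log_T {n : ℕ} (f : Fin n → Fin n) :
    ∑ q ∈ Finset.Icc 2 n, (if (Dset f q).Nonempty then vonMangoldt q else 0)
      ≤ Real.log (T f) := by
  rw [← vonMangoldt_sum, ← Finset.sum_filter]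
  apply Finset.sum_le_sum_of_subset_of_nonneg
  · intro q hq
    simp only [Finset.mem_filter] at hq
    obtain ⟨c, hc⟩ := hq.2
    rw [Dset, Finset.mem_filter] at hc
    refine Nat.mem_divisors.2 ⟨?_, (T_spec f).1.ne'⟩
    refine hc.2.trans ?_
    have h2 := (Equiv.Perm.mem_cycleFactorsFinset_iff.1 hc.1).1.two_le_card_support
    obtain ⟨x, hx⟩ := Finset.card_pos.1 (by omega : 0 < c.support.card)
    rw [card_support_eq f c hc.1 x hx]
    exact per_dvd_T f x.1 x.2
  · intros; exact vonMangoldt_nonneg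

theorem log_diff {n : ℕ} (f : Fin n → Fin n) :
    Real.log (B f) - Real.log (T f) ≤ ∑ q ∈ Finset.Icc 2 n, Real.log q *
      min (∑ v, wt f q v)
      (∑ u, ∑ v, if (∀ k, f^[k] u ≠ v) then wt f q u * wt f q v else 0) := by
  rw [log_B]
  refine (sub_le_sub_left (log_T f) _).trans ?_
  rw [← Finset.sum_sub_distrib]
  apply Finset.sum_le_sum
  intro q hq
  rw [Finset.mem_Icc] at hq
  set m := (Dset f q).card with hm
  have hL : ArithmeticFunction.vonMangoldt q ≤ Real.log q :=
    ArithmeticFunction.vonMangoldt_le_log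
  have hL0 : 0 ≤ ArithmeticFunction.vonMangoldt q := ArithmeticFunction.vonMangoldt_nonneg
  have key : ArithmeticFunction.vonMangoldt q * m -
      (if (Dset f q).Nonempty then ArithmeticFunction.vonMangoldt q else 0) ≤
      ArithmeticFunction.vonMangoldt q * min (m : ℝ) (m * (m - 1)) := by
    split_ifs with h
    · have h1 : 1 ≤ m := Finset.card_pos.2 h
      have h1' : (1:ℝ) ≤ m := by exact_mod_cast h1
      have : (m:ℝ) - 1 ≤ min (m : ℝ) (m * (m - 1)) := by
        apply le_min <;> nlinarith
      nlinarith
    · have : m = 0 := by rw [hm, Finset.card_eq_zero]; simpa using h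
      simp [this]
  have hmin : 0 ≤ min (m : ℝ) (m * (m - 1)) := by
    rcases Nat.eq_zero_or_pos m with h | h
    · simp [h]
    · have h1' : (1:ℝ) ≤ m := by exact_mod_cast h
      apply le_min
      · positivity
      · nlinarith
  refine key.trans (mul_le_mul hL (min_le_min (D1 f q) (D2 f q)) hmin (hL0.trans hL))

noncomputable def Iq (n q : ℕ) : Finset ℕ := (Finset.Icc 1 n).filter fun d => q ∣ d

theorem wt_eq {n : ℕ} (f : Fin n → Fin n) (q : ℕ) (v : Fin n) :
    wt f q v = ∑ d ∈ Iq n q, if Function.minimalPeriod f v = d then (1:ℝ) / d else 0 := by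
  rw [Finset.sum_ite_eq, wt]
  have hle : Function.minimalPeriod f v ≤ n := by
    simpa using Function.minimalPeriod_le_card (f := f) (x := v)
  have : Function.minimalPeriod f v ∈ Iq n q ↔
      0 < Function.minimalPeriod f v ∧ q ∣ Function.minimalPeriod f v := by
    simp only [Iq, Finset.mem_filter, Finset.mem_Icc]
    constructor
    · rintro ⟨⟨h1, h2⟩, h3⟩; exact ⟨by omega, h3⟩
    · rintro ⟨h1, h3⟩; exact ⟨⟨by omega, hle⟩, h3⟩
  simp only [this]

theorem avg1 {n : ℕ} (hn : 0 < n) (q : ℕ) :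
    ∑ f : Fin n → Fin n, ∑ v, wt f q v ≤ (n:ℝ) ^ n * ∑ d ∈ Iq n q, (1:ℝ) / d := by
  have hn' : (0:ℝ) < n := by exact_mod_cast hn
  rw [Finset.sum_comm]
  have h : ∀ v ∈ (Finset.univ : Finset (Fin n)), ∑ f : Fin n → Fin n, wt f q v ≤
      (n:ℝ) ^ n / n * ∑ d ∈ Iq n q, (1:ℝ) / d := by
    intro v _
    simp only [wt_eq]
    rw [Finset.sum_comm, Finset.mul_sum]
    apply Finset.sum_le_sum
    intro d hd
    rw [← Finset.sum_filter, Finset.sum_const, nsmul_eq_mul]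
    have hd0 : 0 < d := by
      simp only [Iq, Finset.mem_filter, Finset.mem_Icc] at hd; omega
    have := count1 v d hd0
    have h' : (n:ℝ) * ((Finset.univ.filter fun f : Fin n → Fin n =>
        Function.minimalPeriod f v = d).card : ℝ) ≤ (n:ℝ) ^ n := by exact_mod_cast this
    gcongr
    rw [le_div_iff₀ hn']
    linarith
  refine (Finset.sum_le_sum h).trans (le_of_eq ?_)
  rw [Finset.sum_const, nsmul_eq_mul, Finset.card_univ, Fintype.card_fin]
  field_simp

theorem avg2 {n : ℕ} (hn : 0 < n) (q : ℕ) :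
    ∑ f : Fin n → Fin n, ∑ u, ∑ v, (if (∀ k, f^[k] u ≠ v) then wt f q u * wt f q v else 0)
      ≤ (n:ℝ) ^ n * (∑ d ∈ Iq n q, (1:ℝ) / d) ^ 2 := by
  have hn' : (0:ℝ) < n := by exact_mod_cast hn
  rw [Finset.sum_comm]
  have h : ∀ u ∈ (Finset.univ : Finset (Fin n)), ∑ f : Fin n → Fin n, ∑ v,
      (if (∀ k, f^[k] u ≠ v) then wt f q u * wt f q v else 0) ≤
      (n:ℝ) * ((n:ℝ) ^ n / n ^ 2 * (∑ d ∈ Iq n q, (1:ℝ) / d) ^ 2) := by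
    intro u _
    rw [Finset.sum_comm]
    have h1 : ∀ v ∈ (Finset.univ : Finset (Fin n)), ∑ f : Fin n → Fin n,
      (if (∀ k, f^[k] u ≠ v) then wt f q u * wt f q v else 0) ≤
      ((n:ℝ) ^ n / n ^ 2 * (∑ d ∈ Iq n q, (1:ℝ) / d) ^ 2) := by
      intro v _
      have h2 : ∀ f ∈ (Finset.univ : Finset (Fin n → Fin n)),
          (if (∀ k, f^[k] u ≠ v) then wt f q u * wt f q v else 0) =
          ∑ d ∈ Iq n q, ∑ e ∈ Iq n q, if (Function.minimalPeriod f u = d ∧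
            Function.minimalPeriod f v = e ∧ ∀ k, f^[k] u ≠ v) then (1:ℝ) / d * (1 / e) else 0 := by
        intro f _
        rw [wt_eq, wt_eq, Finset.sum_mul_sum]
        by_cases hk : ∀ k, f^[k] u ≠ v
        · rw [if_pos hk]
          apply Finset.sum_congr rfl
          intro d _
          apply Finset.sum_congr rfl
          intro e _
          by_cases h1 : Function.minimalPeriod f u = d <;>
          by_cases h2 : Function.minimalPeriod f v = e <;> simp [h1, h2]
          exact fun k hk' => absurd hk' (hk k)
        · rw [if_neg hk]
          symm
          apply Finset.sum_eq_zero
          intro d _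
          apply Finset.sum_eq_zero
          intro e _
          rw [if_neg]
          exact fun h => hk h.2.2
      rw [Finset.sum_congr rfl h2, Finset.sum_comm,
        sq (∑ d ∈ Iq n q, (1:ℝ) / d), Finset.sum_mul_sum, Finset.mul_sum]
      apply Finset.sum_le_sum
      intro d hd
      rw [Finset.sum_comm, Finset.mul_sum]
      apply Finset.sum_le_sum
      intro e he
      rw [← Finset.sum_filter, Finset.sum_const, nsmul_eq_mul]
      have hd0 : 0 < d := by
        simp only [Iq, Finset.mem_filter, Finset.mem_Icc] at hd; omega
      have he0 : 0 < e := by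
        simp only [Iq, Finset.mem_filter, Finset.mem_Icc] at he; omega
      have := count2 u v d e hd0 he0
      have h' : (n:ℝ) ^ 2 * ((Finset.univ.filter fun f : Fin n → Fin n =>
        Function.minimalPeriod f u = d ∧
        Function.minimalPeriod f v = e ∧ ∀ k, f^[k] u ≠ v).card : ℝ) ≤ (n:ℝ) ^ n := by
        exact_mod_cast this
      gcongr
      rw [le_div_iff₀ (by positivity)]
      linarith
    refine (Finset.sum_le_sum h1).trans (le_of_eq ?_)
    rw [Finset.sum_const, nsmul_eq_mul, Finset.card_univ, Fintype.card_fin]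
  refine (Finset.sum_le_sum h).trans (le_of_eq ?_)
  rw [Finset.sum_const, nsmul_eq_mul, Finset.card_univ, Fintype.card_fin]
  field_simp

theorem Iq_sum (n q : ℕ) (hq : 2 ≤ q) (hn : 1 ≤ n) :
    ∑ d ∈ Iq n q, (1:ℝ) / d ≤ (1 + Real.log n) / q := by
  have h1 : ∑ d ∈ Iq n q, (1:ℝ) / d ≤ ∑ m ∈ Finset.Icc 1 n, (1:ℝ) / ((q * m : ℕ) : ℝ) := by
    rw [← Finset.sum_image (f := fun d : ℕ => (1:ℝ) / (d:ℝ)) (g := fun m => q * m)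
      (s := Finset.Icc 1 n)]
    · apply Finset.sum_le_sum_of_subset_of_nonneg
      · intro d hd
        simp only [Iq, Finset.mem_filter, Finset.mem_Icc] at hd
        obtain ⟨m, hm⟩ := hd.2
        refine Finset.mem_image.2 ⟨m, ?_, hm.symm⟩
        rw [Finset.mem_Icc]
        have hle : m ≤ q * m := Nat.le_mul_of_pos_left m (by omega)
        refine ⟨?_, by omega⟩
        rcases Nat.eq_zero_or_pos m with h | h
        · subst h; omega
        · exact h
      · intros; positivity
    · intro a _ b _ hab
      exact Nat.eq_of_mul_eq_mul_left (by omega) hab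
  have h2 := harmonic_le_one_add_log n
  rw [harmonic_eq_sum_Icc] at h2
  push_cast at h2
  have hq0 : (0:ℝ) < q := by positivity
  refine h1.trans ?_
  rw [div_eq_mul_inv, mul_comm]
  refine le_trans (le_of_eq ?_) (mul_le_mul_of_nonneg_left h2 (by positivity : (0:ℝ) ≤ (q:ℝ)⁻¹))
  rw [Finset.mul_sum]
  apply Finset.sum_congr rfl
  intro m _
  push_cast
  rw [one_div, mul_inv]

theorem avg_total {n : ℕ} (hn : 1 ≤ n) :
    ∑ f : Fin n → Fin n, (∑ q ∈ Finset.Icc 2 n, Real.log q *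
      min (∑ v, wt f q v)
      (∑ u, ∑ v, if (∀ k, f^[k] u ≠ v) then wt f q u * wt f q v else 0)) ≤
    (n:ℝ) ^ n * ∑ q ∈ Finset.Icc 2 n, Real.log q *
      min ((1 + Real.log n) / q) (((1 + Real.log n) / q) ^ 2) := by
  rw [Finset.sum_comm, Finset.mul_sum]
  apply Finset.sum_le_sum
  intro q hq
  rw [Finset.mem_Icc] at hq
  rw [← Finset.mul_sum, mul_left_comm]
  have hlog : 0 ≤ Real.log q := Real.log_natCast_nonneg q
  have hI0 : 0 ≤ ∑ d ∈ Iq n q, (1:ℝ) / d := Finset.sum_nonneg (fun _ _ => by positivity)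
  apply mul_le_mul_of_nonneg_left _ hlog
  rw [mul_min_of_nonneg _ _ (by positivity)]
  apply le_min
  · refine (Finset.sum_le_sum (fun f _ => min_le_left _ _)).trans ((avg1 hn q).trans ?_)
    exact mul_le_mul_of_nonneg_left (Iq_sum n q hq.1 hn) (by positivity)
  · refine (Finset.sum_le_sum (fun f _ => min_le_right _ _)).trans ((avg2 hn q).trans ?_)
    exact mul_le_mul_of_nonneg_left (pow_le_pow_left₀ hI0 (Iq_sum n q hq.1 hn) 2) (by positivity)

theorem tail_step (q : ℕ) (hq : 1 ≤ q) :
    Real.log (q + 1 : ℕ) / ((q + 1 : ℕ) : ℝ) ^ 2 ≤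
      (Real.log q + 2) / q - (Real.log (q + 1 : ℕ) + 2) / (q + 1 : ℕ) := by
  have hq0 : (1:ℝ) ≤ q := by exact_mod_cast hq
  push_cast
  set x : ℝ := (q : ℝ)
  have hx : 0 < x := by linarith
  have h1 : Real.log (x + 1) ≤ Real.log x + 1 / x := by
    have : Real.log ((x + 1) / x) ≤ (x + 1) / x - 1 := Real.log_le_sub_one_of_pos (by positivity)
    rw [Real.log_div (by positivity) (by positivity)] at this
    have e : (x + 1) / x - 1 = 1 / x := by field_simp; ring
    linarith
  have h2 : 0 ≤ Real.log (x + 1) := Real.log_nonneg (by linarith)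
  set L := Real.log (x + 1)
  have h3 : (L - 1 / x + 2) / x ≤ (Real.log x + 2) / x := by gcongr; linarith
  refine le_trans ?_ (sub_le_sub_right h3 _)
  have e : (L - 1 / x + 2) / x - (L + 2) / (x + 1) - L / (x + 1) ^ 2 =
      (L * x + (x + 1) * (x - 1)) / (x ^ 2 * (x + 1) ^ 2) := by
    field_simp; ring
  have : 0 ≤ (L * x + (x + 1) * (x - 1)) / (x ^ 2 * (x + 1) ^ 2) := by
    apply div_nonneg _ (by positivity)
    have : 0 ≤ (x+1) * (x-1) := mul_nonneg (by linarith) (by linarith)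
    positivity
  linarith

theorem tail_sum (K m : ℕ) (hK : 1 ≤ K) (hm : K ≤ m) :
    ∑ q ∈ Finset.Ioc K m, Real.log q / (q:ℝ) ^ 2 ≤
      (Real.log K + 2) / K - (Real.log m + 2) / m := by
  induction m, hm using Nat.le_induction with
  | base => simp
  | succ m hm ih =>
    rw [← Finset.insert_Ioc_right_eq_Ioc_add_one hm, Finset.sum_insert (by simp)]
    have := tail_step m (by omega)
    linarith

theorem main_sum (n K : ℕ) (H : ℝ) (hH : 0 ≤ H) (hHK : H ≤ K) (hK : 1 ≤ K) :
    ∑ q ∈ Finset.Icc 2 n, Real.log q * min (H / q) ((H / q) ^ 2) ≤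
      H * (Real.log K * (1 + Real.log K) + (Real.log K + 2)) := by
  have hK0 : (1:ℝ) ≤ K := by exact_mod_cast hK
  have hlK : 0 ≤ Real.log K := Real.log_natCast_nonneg K
  have hsub : Finset.Icc 2 n ⊆ Finset.Icc 1 K ∪ Finset.Ioc K (max K n) := by
    intro q hq
    simp only [Finset.mem_Icc, Finset.mem_union, Finset.mem_Ioc] at hq ⊢
    by_cases h : q ≤ K
    · left; omega
    · right; exact ⟨by omega, le_max_of_le_right hq.2⟩
  have hterm : ∀ q : ℕ, 0 ≤ Real.log q * min (H / q) ((H / q) ^ 2) := by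
    intro q
    exact mul_nonneg (Real.log_natCast_nonneg q) (le_min (by positivity) (by positivity))
  refine (Finset.sum_le_sum_of_subset_of_nonneg hsub (fun q _ _ => hterm q)).trans ?_
  rw [Finset.sum_union]
  · have h1 : ∑ q ∈ Finset.Icc 1 K, Real.log q * min (H / q) ((H / q) ^ 2) ≤
        H * (Real.log K * (1 + Real.log K)) := by
      have h2 := harmonic_le_one_add_log K
      rw [harmonic_eq_sum_Icc] at h2
      push_cast at h2
      calc _ ≤ ∑ q ∈ Finset.Icc 1 K, (H * Real.log K) * (q:ℝ)⁻¹ := by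
            apply Finset.sum_le_sum
            intro q hq
            rw [Finset.mem_Icc] at hq
            have hq1 : (0:ℝ) < q := by exact_mod_cast hq.1
            have : Real.log q ≤ Real.log K := Real.log_le_log hq1 (by exact_mod_cast hq.2)
            calc _ ≤ Real.log K * (H / q) :=
                  mul_le_mul this (min_le_left _ _) (le_min (by positivity) (by positivity)) hlK
              _ = _ := by ring
        _ = (H * Real.log K) * ∑ q ∈ Finset.Icc 1 K, (q:ℝ)⁻¹ := by rw [Finset.mul_sum]
        _ ≤ (H * Real.log K) * (1 + Real.log K) := by gcongr
        _ = _ := by ring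
    have h3 : ∑ q ∈ Finset.Ioc K (max K n), Real.log q * min (H / q) ((H / q) ^ 2) ≤
        H * (Real.log K + 2) := by
      have ht := tail_sum K (max K n) hK (le_max_left _ _)
      have hp : 0 ≤ (Real.log (max K n : ℕ) + 2) / (max K n : ℕ) := by
        have := Real.log_natCast_nonneg (max K n)
        positivity
      calc _ ≤ ∑ q ∈ Finset.Ioc K (max K n), H ^ 2 * (Real.log q / (q:ℝ) ^ 2) := by
            apply Finset.sum_le_sum
            intro q hq
            calc _ ≤ Real.log q * ((H / q) ^ 2) :=
                  mul_le_mul_of_nonneg_left (min_le_right _ _) (Real.log_natCast_nonneg q)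
              _ = _ := by ring
        _ = H ^ 2 * ∑ q ∈ Finset.Ioc K (max K n), Real.log q / (q:ℝ) ^ 2 := by
            rw [Finset.mul_sum]
        _ ≤ H ^ 2 * ((Real.log K + 2) / K) := by gcongr; linarith
        _ = H * (Real.log K + 2) * (H / K) := by ring
        _ ≤ H * (Real.log K + 2) * 1 := by
            gcongr
            rw [div_le_one (by linarith)]; exact hHK
        _ = _ := by ring
    linarith
  · rw [Finset.disjoint_left]
    intro q hq hq'
    simp only [Finset.mem_Icc, Finset.mem_Ioc] at hq hq'
    omega

theorem final_bound (n : ℕ) (hn : Real.exp (Real.exp 2) ≤ n) :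
    ∑ q ∈ Finset.Icc 2 n, Real.log q *
      min ((1 + Real.log n) / q) (((1 + Real.log n) / q) ^ 2) ≤
    20 * Real.log n * (Real.log (Real.log n)) ^ 2 := by
  have hn0 : (0:ℝ) < n := lt_of_lt_of_le (Real.exp_pos _) hn
  have hL : Real.exp 2 ≤ Real.log n := (Real.le_log_iff_exp_le hn0).2 hn
  have hL3 : 3 ≤ Real.log n := by have := Real.add_one_le_exp (2:ℝ); linarith
  have hLL : 2 ≤ Real.log (Real.log n) := (Real.le_log_iff_exp_le (by linarith)).2 hL
  set L := Real.log n
  set K := ⌈1 + L⌉₊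
  have hK1 : 1 + L ≤ K := Nat.le_ceil _
  have hK2 : (K:ℝ) < 1 + L + 1 := Nat.ceil_lt_add_one (by linarith)
  have hK : 1 ≤ K := by
    have : (1:ℝ) ≤ K := by linarith
    exact_mod_cast this
  refine (main_sum n K (1 + L) (by linarith) hK1 hK).trans ?_
  have hlK : Real.log K ≤ 2 * Real.log L := by
    rw [← Real.log_rpow (by linarith)]
    apply Real.log_le_log (by linarith)
    norm_num
    nlinarith
  have hlK0 : 0 ≤ Real.log K := Real.log_natCast_nonneg K
  set M' := Real.log L
  calc (1 + L) * (Real.log K * (1 + Real.log K) + (Real.log K + 2)) ≤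
      (2 * L) * ((2 * M') * (1 + 2 * M') + (2 * M' + 2)) := by
        gcongr; linarith
    _ ≤ (2 * L) * (10 * M' ^ 2) := by
        gcongr; nlinarith
    _ = _ := by ring

/-- a tail bound for `log B - log T` under the uniform measure. -/
theorem typical_B_T :
    ∃ c > (0 : ℝ), ∃ N : ℕ, ∀ n : ℕ, N ≤ n → ∀ l : ℝ, 0 < l →
      ((Finset.univ.filter fun f : Fin n → Fin n =>
          l ≤ Real.log (B f) - Real.log (T f)).card : ℝ) / (n : ℝ) ^ n ≤
        c * Real.log n * (Real.log (Real.log n)) ^ 2 / l := by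
  refine ⟨20, by norm_num, ⌈Real.exp (Real.exp 2)⌉₊, ?_⟩
  intro n hn l hl
  have hn' : Real.exp (Real.exp 2) ≤ n := (Nat.le_ceil _).trans (by exact_mod_cast hn)
  have hn0 : (0:ℝ) < n := lt_of_lt_of_le (Real.exp_pos _) hn'
  have hn1 : 1 ≤ n := by exact_mod_cast hn0
  set X : (Fin n → Fin n) → ℝ := fun f => ∑ q ∈ Finset.Icc 2 n, Real.log q *
      min (∑ v, wt f q v)
      (∑ u, ∑ v, if (∀ k, f^[k] u ≠ v) then wt f q u * wt f q v else 0) with hX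
  have hX0 : ∀ f, 0 ≤ X f := by
    intro f
    simp only [hX]
    apply Finset.sum_nonneg
    intro q _
    apply mul_nonneg (Real.log_natCast_nonneg q)
    apply le_min
    · exact Finset.sum_nonneg (fun v _ => wt_nonneg f q v)
    · apply Finset.sum_nonneg; intro u _
      apply Finset.sum_nonneg; intro v _
      split_ifs
      · exact mul_nonneg (wt_nonneg _ _ _) (wt_nonneg _ _ _)
      · exact le_rfl
  have hsum : ∑ f, X f ≤ (n:ℝ) ^ n * (20 * Real.log n * (Real.log (Real.log n)) ^ 2) :=
    (avg_total hn1).trans (mul_le_mul_of_nonneg_left (final_bound n hn') (by positivity))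
  have hmk : ((Finset.univ.filter fun f : Fin n → Fin n =>
          l ≤ Real.log (B f) - Real.log (T f)).card : ℝ) * l ≤ ∑ f, X f := by
    rw [← nsmul_eq_mul, ← Finset.sum_const]
    refine le_trans (Finset.sum_le_sum (g := X) ?_)
      (Finset.sum_le_sum_of_subset_of_nonneg (Finset.filter_subset _ _) (fun f _ _ => hX0 f))
    intro f hf
    exact (Finset.mem_filter.1 hf).2.trans (log_diff f)
  rw [div_le_div_iff₀ (by positivity) hl]
  linarith

end IterMap
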